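/- Let k ≥ 3 and n ≥ k+1 be integers. Let A be a connected graph with maximum degree at most k−1, with 2·|E(A)| ≥ n(k−2)+1, with at least k vertices, and with at least k+1 vertices whenever n ≥ k+2. If k is even, or if k is odd and n ≥ k+2, then A contains a matching of size at least ⌈k/2⌉; if k is odd and n = k+1, then A contains a matching of size at least (k−1)/2. -/

import Mathlib

/-- An indexed family of vertex-disjoint edges of `A`. -/
def IsM {V ι : Type*} (A : SimpleGraph V) (a b : ι → V) : Prop :=
  (∀ i j, a i = a j → i = j) ∧ (∀ i j, b i = b j → i = j) ∧ (∀ i j, a i ≠ b j) ∧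
    ∀ i, A.Adj (a i) (b i)

/-- A vertex missed by the family. -/
def IsOut {V ι : Type*} (a b : ι → V) (x : V) : Prop := (∀ i, x ≠ a i) ∧ ∀ i, x ≠ b i

theorem aug1 {V ι : Type*} (A : SimpleGraph V) (a b : ι → V) (h : IsM A a b)
    (hmax : ¬ ∃ a' b' : Option ι → V, IsM A a' b') (x y : V)
    (hx : IsOut a b x) (hy : IsOut a b y) : ¬ A.Adj x y := by
  intro hxy
  apply hmax
  obtain ⟨h1, h2, h3, h4⟩ := h
  obtain ⟨x1, x2⟩ := hx
  obtain ⟨y1, y2⟩ := hy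
  have := hxy.ne
  refine ⟨fun o => o.elim x a, fun o => o.elim y b, ?_, ?_, ?_, ?_⟩
  · rintro (_ | i) (_ | j) <;> simp <;> grind
  · rintro (_ | i) (_ | j) <;> simp <;> grind
  · rintro (_ | i) (_ | j) <;> simp <;> grind
  · rintro (_ | i) <;> simp <;> grind

theorem aug2 {V ι : Type*} (A : SimpleGraph V) (a b : ι → V) (h : IsM A a b)
    (hmax : ¬ ∃ a' b' : Option ι → V, IsM A a' b') (x y : V)
    (hx : IsOut a b x) (hy : IsOut a b y) (hne : x ≠ y) (i : ι)
    (hxi : A.Adj (a i) x) (hyi : A.Adj (b i) y) : False := by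
  classical
  apply hmax
  obtain ⟨h1, h2, h3, h4⟩ := h
  obtain ⟨x1, x2⟩ := hx
  obtain ⟨y1, y2⟩ := hy
  refine ⟨fun o => o.elim y a, fun o => o.elim (b i) (fun j => if j = i then x else b j),
    ?_, ?_, ?_, ?_⟩
  · rintro (_ | i) (_ | j) <;> simp <;> grind
  · rintro (_ | i) (_ | j) <;> simp <;> grind
  · rintro (_ | i) (_ | j) <;> simp <;> grind
  · rintro (_ | j)
    · simpa using hyi.symm
    · by_cases hj : j = i
      · subst hj; simpa using hxi
      · simpa [hj] using h4 j

theorem aug3 {V ι : Type*} (A : SimpleGraph V) (a b : ι → V) (h : IsM A a b)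
    (hmax : ¬ ∃ a' b' : Option ι → V, IsM A a' b') (x y : V)
    (hx : IsOut a b x) (hy : IsOut a b y) (hne : x ≠ y) (i j : ι) (hij : i ≠ j)
    (hxi : A.Adj (a i) x) (hyi : A.Adj (a j) y) : ¬ A.Adj (b i) (b j) := by
  classical
  intro hb
  apply hmax
  obtain ⟨h1, h2, h3, h4⟩ := h
  obtain ⟨x1, x2⟩ := hx
  obtain ⟨y1, y2⟩ := hy
  refine ⟨fun o => o.elim (b i) a,
    fun o => o.elim (b j) (fun l => if l = i then x else if l = j then y else b l),
    ?_, ?_, ?_, ?_⟩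
  · rintro (_ | i) (_ | j) <;> simp <;> grind
  · rintro (_ | i) (_ | j) <;> simp <;> grind
  · rintro (_ | i) (_ | j) <;> simp <;> grind
  · rintro (_ | l)
    · simpa using hb
    · by_cases hl : l = i
      · subst hl; simpa using hxi
      · by_cases hl' : l = j
        · subst hl'; simpa [hl] using hyi
        · simpa [hl, hl'] using h4 l

/-- The vertex `v` has two distinct neighbours missed by the family. -/
def TwoOut {V ι : Type*} (A : SimpleGraph V) (a b : ι → V) (v : V) : Prop :=
  ∃ x y, x ≠ y ∧ IsOut a b x ∧ IsOut a b y ∧ A.Adj v x ∧ A.Adj v y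

theorem orient {V ι : Type*} (A : SimpleGraph V) (a b : ι → V) (h : IsM A a b)
    (hmax : ¬ ∃ a' b' : Option ι → V, IsM A a' b') :
    ∃ a' b' : ι → V, IsM A a' b' ∧ ∀ i, ¬ TwoOut A a' b' (b' i) := by
  classical
  obtain ⟨h1, h2, h3, h4⟩ := h
  let a' : ι → V := fun i => if TwoOut A a b (b i) then b i else a i
  let b' : ι → V := fun i => if TwoOut A a b (b i) then a i else b i
  have hout : ∀ x, IsOut a' b' x ↔ IsOut a b x := by
    intro x
    simp only [IsOut, a', b']
    constructor
    · rintro ⟨p, q⟩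
      constructor <;> intro i <;> have := p i <;> have := q i <;> grind
    · rintro ⟨p, q⟩
      constructor <;> intro i <;> have := p i <;> have := q i <;> grind
  refine ⟨a', b', ⟨?_, ?_, ?_, ?_⟩, ?_⟩
  · intro i j; simp only [a']; have := h3 i j; have := h3 j i; grind
  · intro i j; simp only [b']; have := h3 i j; have := h3 j i; grind
  · intro i j; simp only [a', b']; have := h3 i j; have := h3 j i; grind
  · intro i; simp only [a', b']; split_ifs
    · exact (h4 i).symm
    · exact h4 i
  · rintro i ⟨x, y, hne, hx, hy, hix, hiy⟩
    rw [hout] at hx hy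
    by_cases ht : TwoOut A a b (b i)
    · have hb : b' i = a i := by simp [b', ht]
      rw [hb] at hix hiy
      obtain ⟨z, w, hzw, hz, hw, hiz, hiw⟩ := ht
      by_cases hxz : x = z
      · subst hxz
        exact aug2 A a b ⟨h1, h2, h3, h4⟩ hmax x w hx hw hzw i hix hiw
      · exact aug2 A a b ⟨h1, h2, h3, h4⟩ hmax x z hx hz hxz i hix hiz
    · have hb : b' i = b i := by simp [b', ht]
      rw [hb] at hix hiy
      exact ht ⟨x, y, hne, hx, hy, hix, hiy⟩

open Finset in
theorem bound {V ι : Type*} [Fintype V] [Fintype ι] (A : SimpleGraph V) (D : ℕ)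
    (hdeg : ∀ v : V, (A.neighborSet v).ncard ≤ D)
    (a₀ b₀ : ι → V) (h₀ : IsM A a₀ b₀)
    (hmax : ¬ ∃ a' b' : Option ι → V, IsM A a' b') :
    ∃ p h, p + h = Fintype.card ι ∧
      2 * A.edgeSet.ncard ≤ 2 * (p * D) + 2 * h * (2 * (p + h) + 1) := by
  classical
  obtain ⟨a, b, hM, hb2⟩ := orient A a₀ b₀ h₀ hmax
  have hM' := hM
  obtain ⟨h1, h2, h3, h4⟩ := hM'
  let B : Finset ι := univ.filter fun i => TwoOut A a b (a i)
  let C : Finset ι := univ.filter fun i => ¬ TwoOut A a b (a i)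
  have hBC : B.card + C.card = Fintype.card ι := by
    simpa using card_filter_add_card_filter_not (s := (univ : Finset ι))
      (fun i => TwoOut A a b (a i))
  refine ⟨B.card, C.card, hBC, ?_⟩
  let N : V → Finset V := fun v => univ.filter fun x => A.Adj v x
  have hN : ∀ v, (N v).card ≤ D := by
    intro v
    have := hdeg v
    rw [Set.ncard_eq_toFinset_card'] at this
    convert this using 2
    ext x; simp [N]
  let O : V → Finset V := fun v => univ.filter fun x => A.Adj v x ∧ IsOut a b x
  let H : Finset V := C.image a ∪ C.image b
  let vB : Finset V := B.image b
  have hH : H.card ≤ 2 * C.card := by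
    calc H.card ≤ (C.image a).card + (C.image b).card := card_union_le _ _
      _ ≤ C.card + C.card := add_le_add card_image_le card_image_le
      _ = _ := by ring
  have hvB : vB.card ≤ B.card := card_image_le
  have hO : ∀ v ∈ H, (O v).card ≤ 1 := by
    intro v hv
    have hT : ¬ TwoOut A a b v := by
      simp only [H, C, mem_union, mem_image, mem_filter, mem_univ, true_and] at hv
      rcases hv with ⟨i, hi, rfl⟩ | ⟨i, hi, rfl⟩
      · exact hi
      · exact hb2 i
    rw [card_le_one]
    intro x hx y hy
    simp only [O, mem_filter, mem_univ, true_and] at hx hy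
    by_contra hne
    exact hT ⟨x, y, hne, hx.2, hy.2, hx.1, hy.1⟩
  let P : Finset (V × V) := univ.filter fun p => A.Adj p.1 p.2
  have hP : 2 * A.edgeSet.ncard = P.card := by
    have e1 := A.sum_degrees_eq_twice_card_edges
    have e2 : A.edgeSet.ncard = A.edgeFinset.card := by
      rw [Set.ncard_eq_toFinset_card']; rfl
    rw [e2, ← e1, ← A.dart_card_eq_sum_degrees, ← Fintype.card_coe P]
    exact Fintype.card_congr
      ⟨fun d => ⟨d.toProd, by simp [P, d.adj]⟩, fun p => ⟨p.1, (mem_filter.1 p.2).2⟩,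
        fun _ => rfl, fun _ => rfl⟩
  let S1 : Finset (V × V) := B.biUnion fun i => (N (a i)).image fun x => (a i, x)
  let S2 : Finset (V × V) := H.biUnion fun v => (O v).image fun x => (v, x)
  let Q : Finset (V × V) := S1 ∪ (H ×ˢ vB) ∪ S2
  have hS1 : S1.card ≤ B.card * D :=
    card_biUnion_le_card_mul _ _ _ fun i _ => card_image_le.trans (hN _)
  have hS2 : S2.card ≤ H.card * 1 :=
    card_biUnion_le_card_mul _ _ _ fun v hv => card_image_le.trans (hO v hv)
  have hQ : Q.card ≤ B.card * D + H.card * vB.card + H.card := by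
    calc Q.card ≤ (S1 ∪ (H ×ˢ vB)).card + S2.card := card_union_le _ _
      _ ≤ S1.card + (H ×ˢ vB).card + S2.card := by gcongr; exact card_union_le _ _
      _ ≤ _ := by rw [card_product]; omega
  have hclass : ∀ x, (∃ i ∈ B, x = a i) ∨ x ∈ vB ∨ x ∈ H ∨ IsOut a b x := by
    intro x
    by_cases hx : IsOut a b x
    · tauto
    · simp only [IsOut, not_and_or, not_forall, not_not] at hx
      rcases hx with ⟨i, rfl⟩ | ⟨i, rfl⟩ <;> by_cases hi : TwoOut A a b (a i)
      · exact Or.inl ⟨i, by simp [B, hi], rfl⟩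
      · exact Or.inr (Or.inr (Or.inl (mem_union_left _ (mem_image_of_mem _ (by simp [C, hi])))))
      · exact Or.inr (Or.inl (mem_image_of_mem _ (by simp [B, hi])))
      · exact Or.inr (Or.inr (Or.inl (mem_union_right _ (mem_image_of_mem _ (by simp [C, hi])))))
  have hvv : ∀ x ∈ vB, ∀ y ∈ vB, ¬ A.Adj x y := by
    intro x hx y hy hxy
    simp only [vB, B, mem_image, mem_filter, mem_univ, true_and] at hx hy
    obtain ⟨i, ⟨x1, x2, hn, o1, o2, g1, g2⟩, rfl⟩ := hx
    obtain ⟨j, ⟨y1, y2, hn', o1', o2', g1', g2'⟩, rfl⟩ := hy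
    have hij : i ≠ j := by rintro rfl; exact hxy.ne rfl
    by_cases hc : x1 = y1
    · exact aug3 A a b hM hmax x1 y2 o1 o2' (by rw [hc]; exact hn') i j hij g1 g2' hxy
    · exact aug3 A a b hM hmax x1 y1 o1 o1' hc i j hij g1 g1' hxy
  have hvo : ∀ x ∈ vB, ∀ y, IsOut a b y → ¬ A.Adj x y := by
    intro x hx y hy hxy
    simp only [vB, B, mem_image, mem_filter, mem_univ, true_and] at hx
    obtain ⟨i, ⟨x1, x2, hn, o1, o2, g1, g2⟩, rfl⟩ := hx
    by_cases hc : x1 = y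
    · subst hc
      exact aug2 A a b hM hmax x2 x1 o2 hy hn.symm i g2 hxy
    · exact aug2 A a b hM hmax x1 y o1 hy hc i g1 hxy
  have hcov : P ⊆ Q ∪ Q.image Prod.swap ∪ H.offDiag := by
    rintro ⟨x, y⟩ hxy
    simp only [P, mem_filter, mem_univ, true_and] at hxy
    have key : ∀ x y, A.Adj x y → (∃ i ∈ B, x = a i) → (x, y) ∈ Q := by
      rintro x y hxy ⟨i, hi, rfl⟩
      refine mem_union_left _ (mem_union_left _ (mem_biUnion.2 ⟨i, hi, mem_image_of_mem _ ?_⟩))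
      simpa [N] using hxy
    have key2 : ∀ x y, x ∈ H → y ∈ vB → (x, y) ∈ Q := by
      intro x y hx hy
      exact mem_union_left _ (mem_union_right _ (mem_product.2 ⟨hx, hy⟩))
    have key3 : ∀ x y, A.Adj x y → x ∈ H → IsOut a b y → (x, y) ∈ Q := by
      intro x y hxy hx hy
      refine mem_union_right _ (mem_biUnion.2 ⟨x, hx, mem_image_of_mem _ ?_⟩)
      simpa [O] using ⟨hxy, hy⟩
    have hl : (x, y) ∈ Q → (x, y) ∈ Q ∪ Q.image Prod.swap ∪ H.offDiag := fun h =>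
      mem_union_left _ (mem_union_left _ h)
    have hr : (y, x) ∈ Q → (x, y) ∈ Q ∪ Q.image Prod.swap ∪ H.offDiag := fun h =>
      mem_union_left _ (mem_union_right _ (mem_image.2 ⟨_, h, rfl⟩))
    have hyx := hxy.symm
    rcases hclass x with hx | hx | hx | hx
    · exact hl (key _ _ hxy hx)
    all_goals rcases hclass y with hy | hy | hy | hy
    · exact hr (key _ _ hyx hy)
    · exact absurd hxy (hvv _ hx _ hy)
    · exact hr (key2 _ _ hy hx)
    · exact absurd hxy (hvo _ hx _ hy)
    · exact hr (key _ _ hyx hy)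
    · exact hl (key2 _ _ hx hy)
    · exact mem_union_right _ (mem_offDiag.2 ⟨hx, hy, hxy.ne⟩)
    · exact hl (key3 _ _ hxy hx hy)
    · exact hr (key _ _ hyx hy)
    · exact absurd hyx (hvo _ hy _ hx)
    · exact hr (key3 _ _ hyx hy hx)
    · exact absurd hxy (aug1 A a b hM hmax _ _ hx hy)
  have hfin : P.card ≤ Q.card + Q.card + (H.card * H.card - H.card) := by
    calc P.card ≤ _ := card_le_card hcov
      _ ≤ (Q ∪ Q.image Prod.swap).card + H.offDiag.card := card_union_le _ _
      _ ≤ Q.card + (Q.image Prod.swap).card + H.offDiag.card := by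
        gcongr; exact card_union_le _ _
      _ ≤ _ := by rw [offDiag_card]; exact Nat.add_le_add_right (Nat.add_le_add_left card_image_le _) _
  rw [hP]
  have hsub : H.card * H.card - H.card + H.card = H.card * H.card :=
    Nat.sub_add_cancel (Nat.le_mul_self _)
  generalize H.card * H.card - H.card = w at *
  have m1 : H.card * vB.card ≤ 2 * C.card * B.card := Nat.mul_le_mul hH hvB
  have m2 : H.card * H.card ≤ 2 * C.card * (2 * C.card) := Nat.mul_le_mul hH hH
  have m3 : w + 2 * H.card ≤ 2 * C.card * (2 * C.card) + 2 * C.card := by omega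
  nlinarith

theorem toSubgraph {V : Type*} [Fintype V] (A : SimpleGraph V) (m : ℕ) (a b : Fin m → V)
    (h : IsM A a b) : ∃ M : A.Subgraph, M.IsMatching ∧ m ≤ M.edgeSet.ncard := by
  obtain ⟨h1, h2, h3, h4⟩ := h
  let M : A.Subgraph :=
    { verts := {x | ∃ i, x = a i ∨ x = b i}
      Adj := fun x y => ∃ i, (x = a i ∧ y = b i) ∨ (x = b i ∧ y = a i)
      adj_sub := by
        rintro x y ⟨i, ⟨rfl, rfl⟩ | ⟨rfl, rfl⟩⟩
        · exact h4 i
        · exact (h4 i).symm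
      edge_vert := by
        rintro x y ⟨i, ⟨rfl, rfl⟩ | ⟨rfl, rfl⟩⟩
        · exact ⟨i, Or.inl rfl⟩
        · exact ⟨i, Or.inr rfl⟩
      symm := ⟨by
        rintro x y ⟨i, h | h⟩
        · exact ⟨i, Or.inr ⟨h.2, h.1⟩⟩
        · exact ⟨i, Or.inl ⟨h.2, h.1⟩⟩⟩ }
  refine ⟨M, ?_, ?_⟩
  · rintro x ⟨i, rfl | rfl⟩
    · refine ⟨b i, ⟨i, Or.inl ⟨rfl, rfl⟩⟩, ?_⟩
      rintro y ⟨j, ⟨e, rfl⟩ | ⟨e, rfl⟩⟩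
      · rw [h1 _ _ e]
      · exact absurd e (h3 _ _)
    · refine ⟨a i, ⟨i, Or.inr ⟨rfl, rfl⟩⟩, ?_⟩
      rintro y ⟨j, ⟨e, rfl⟩ | ⟨e, rfl⟩⟩
      · exact absurd e.symm (h3 _ _)
      · rw [h2 _ _ e]
  · have hinj : Function.Injective (fun i => s(a i, b i)) := by
      intro i j hij
      simp only [Sym2.eq_iff] at hij
      rcases hij with h | h
      · exact h1 _ _ h.1
      · exact absurd h.1 (h3 _ _)
    have hr : (Set.range (fun i => s(a i, b i))).ncard = m := by
      rw [← Set.image_univ, Set.ncard_image_of_injective _ hinj, Set.ncard_univ]; simp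
    calc m = _ := hr.symm
      _ ≤ _ := Set.ncard_le_ncard (by
        rintro _ ⟨i, rfl⟩
        exact ⟨i, Or.inl ⟨rfl, rfl⟩⟩) (Set.toFinite _)

/-- Either a matching of size `t`, or a maximum matching of smaller size. -/
theorem matching_or_max {V : Type*} (A : SimpleGraph V) (t : ℕ) :
    (∃ a b : Fin t → V, IsM A a b) ∨
    ∃ m < t, (∃ a b : Fin m → V, IsM A a b) ∧
      ¬ ∃ a' b' : Option (Fin m) → V, IsM A a' b' := by
  induction t with
  | zero => exact Or.inl ⟨Fin.elim0, Fin.elim0, fun i => i.elim0, fun i => i.elim0,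
      fun i => i.elim0, fun i => i.elim0⟩
  | succ t ih =>
    rcases ih with h | ⟨m, hm, h⟩
    · by_cases h' : ∃ a' b' : Option (Fin t) → V, IsM A a' b'
      · left
        obtain ⟨a, b, h1, h2, h3, h4⟩ := h'
        let e := finSuccEquivLast (n := t)
        exact ⟨a ∘ e, b ∘ e, fun i j hh => e.injective (h1 _ _ hh),
          fun i j hh => e.injective (h2 _ _ hh), fun i j => h3 _ _, fun i => h4 _⟩
      · exact Or.inr ⟨t, by omega, h, h'⟩
    · exact Or.inr ⟨m, by omega, h⟩

/-- The exceptional case `k = 3`, with a maximum matching of size one. -/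
theorem three {V : Type*} [Fintype V] (A : SimpleGraph V) (hconn : A.Connected)
    (hdeg : ∀ v : V, (A.neighborSet v).ncard ≤ 2)
    (hV : 4 ≤ Fintype.card V)
    (a b : Fin 1 → V) (h : IsM A a b)
    (hmax : ¬ ∃ a' b' : Option (Fin 1) → V, IsM A a' b') : False := by
  classical
  have a1 := aug1 A a b h hmax
  have a2 := aug2 A a b h hmax
  obtain ⟨h1, h2, h3, h4⟩ := h
  have hout : ∀ x, x ≠ a 0 → x ≠ b 0 → IsOut a b x := by
    intro x hx hy
    constructor <;> intro i <;> rw [Subsingleton.elim i 0] <;> assumption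
  have hab := h4 0
  have a20 : ∀ x y, IsOut a b x → IsOut a b y → x ≠ y → A.Adj (a 0) x → A.Adj (b 0) y → False :=
    fun x y hx hy hne => a2 x y hx hy hne 0
  generalize a 0 = u at *
  generalize b 0 = v at *
  have hc : 1 < (Finset.univ \ {u, v} : Finset V).card := by
    have e1 := Finset.le_card_sdiff {u, v} (Finset.univ : Finset V)
    have e2 : ({u, v} : Finset V).card ≤ 2 := Finset.card_le_two
    rw [Finset.card_univ] at e1
    omega
  obtain ⟨x, hx, y, hy, hxy⟩ := Finset.one_lt_card.1 hc
  simp only [Finset.mem_sdiff, Finset.mem_univ, true_and, Finset.mem_insert,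
    Finset.mem_singleton, not_or] at hx hy
  have hox := hout x hx.1 hx.2
  have hoy := hout y hy.1 hy.2
  have hadj : ∀ w, IsOut a b w → A.Adj u w ∨ A.Adj v w := by
    intro w hw
    have : Nontrivial V := ⟨x, y, hxy⟩
    obtain ⟨z, hz⟩ := hconn.preconnected.exists_adj_of_nontrivial w
    by_cases hzu : z = u
    · exact Or.inl (hzu ▸ hz.symm)
    by_cases hzv : z = v
    · exact Or.inr (hzv ▸ hz.symm)
    exact absurd hz (a1 w z hw (hout z hzu hzv))
  have hthree : ∀ p q, A.Adj p q → q ≠ x → q ≠ y → A.Adj p x → A.Adj p y → False := by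
    intro p q g1 g2 g3 g4 g5
    have hs : ({q, x, y} : Set V) ⊆ A.neighborSet p := by
      rintro w (rfl | rfl | rfl) <;> assumption
    have e1 := Set.ncard_le_ncard hs (Set.toFinite _)
    have e2 : ({q, x, y} : Set V).ncard = 3 := Set.ncard_eq_three.2 ⟨q, x, y, g2, g3, hxy, rfl⟩
    have e3 := hdeg p
    omega
  rcases hadj x hox with gx | gx <;> rcases hadj y hoy with gy | gy
  · exact hthree u v hab (Ne.symm hx.2) (Ne.symm hy.2) gx gy
  · exact a20 x y hox hoy hxy gx gy
  · exact a20 y x hoy hox hxy.symm gy gx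
  · exact hthree v u hab.symm (Ne.symm hx.1) (Ne.symm hy.1) gx gy

theorem large_matching_in_A {V : Type*} [Fintype V]
    (k n : ℕ) (hk : 3 ≤ k) (hn : k + 1 ≤ n)
    (A : SimpleGraph V) (hconn : A.Connected)
    (hdeg : ∀ v : V, (A.neighborSet v).ncard ≤ k - 1)
    (hE : n * (k - 2) + 1 ≤ 2 * A.edgeSet.ncard)
    (hV : k ≤ Fintype.card V)
    (hV' : k + 2 ≤ n → k + 1 ≤ Fintype.card V) :
    ((Even k ∨ (Odd k ∧ k + 2 ≤ n)) →
      ∃ M : A.Subgraph, M.IsMatching ∧ (k + 1) / 2 ≤ M.edgeSet.ncard) ∧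
    ((Odd k ∧ n = k + 1) →
      ∃ M : A.Subgraph, M.IsMatching ∧ (k - 1) / 2 ≤ M.edgeSet.ncard) := by
  have small : ∀ m, 2 * m + 2 ≤ k → (∃ a b : Fin m → V, IsM A a b) →
      ¬ (¬ ∃ a' b' : Option (Fin m) → V, IsM A a' b') := by
    rintro m hm ⟨a, b, hM⟩ hmax
    obtain ⟨p, h, hph, hb⟩ := bound A (k - 1) hdeg a b hM hmax
    simp only [Fintype.card_fin] at hph
    obtain ⟨k, rfl⟩ := Nat.exists_eq_add_of_le' (show 2 ≤ k by omega)
    have e1 : k + 2 - 1 = k + 1 := by omega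
    have e2 : k + 2 - 2 = k := by omega
    rw [e1] at hb
    rw [e2] at hE
    have q1 : 2 * h * (2 * (p + h) + 1) ≤ 2 * h * (k + 1) := Nat.mul_le_mul le_rfl (by omega)
    have q2 : 2 * (p * (k + 1)) + 2 * h * (k + 1) = 2 * m * (k + 1) := by rw [← hph]; ring
    have q3 : 2 * m * (k + 1) ≤ k * (k + 1) := Nat.mul_le_mul (by omega) le_rfl
    have q4 : (k + 3) * k ≤ n * k := Nat.mul_le_mul (by omega) le_rfl
    nlinarith
  constructor
  · intro hcase
    rcases matching_or_max A ((k + 1) / 2) with ⟨a, b, hM⟩ | ⟨m, hm, ⟨a, b, hM⟩, hmax⟩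
    · exact toSubgraph A _ a b hM
    exfalso
    by_cases hs : 2 * m + 2 ≤ k
    · exact small m hs ⟨a, b, hM⟩ hmax
    have hkm : k = 2 * m + 1 := by omega
    have hn2 : k + 2 ≤ n := by
      rcases hcase with ⟨r, hr⟩ | h
      · omega
      · exact h.2
    have hV4 := hV' hn2
    by_cases hm1 : m = 1
    · subst hm1
      subst hkm
      exact three A hconn hdeg hV4 a b hM hmax
    obtain ⟨p, h, hph, hb⟩ := bound A (k - 1) hdeg a b hM hmax
    simp only [Fintype.card_fin] at hph
    obtain ⟨l, rfl⟩ := Nat.exists_eq_add_of_le' (show 2 ≤ m by omega)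
    subst hkm
    have e1 : 2 * (l + 2) + 1 - 1 = 2 * l + 4 := by omega
    have e2 : 2 * (l + 2) + 1 - 2 = 2 * l + 3 := by omega
    rw [e1, hph] at hb
    rw [e2] at hE
    have q1 : 2 * (p * (2 * l + 4)) ≤ 2 * (p * (2 * (l + 2) + 1)) :=
      Nat.mul_le_mul le_rfl (Nat.mul_le_mul le_rfl (by omega))
    have q2 : 2 * (p * (2 * (l + 2) + 1)) + 2 * h * (2 * (l + 2) + 1)
      = 2 * (l + 2) * (2 * (l + 2) + 1) := by rw [← hph]; ring
    have q4 : (2 * l + 7) * (2 * l + 3) ≤ n * (2 * l + 3) := Nat.mul_le_mul (by omega) le_rfl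
    nlinarith
  · rintro ⟨⟨r, hr⟩, -⟩
    rcases matching_or_max A ((k - 1) / 2) with ⟨a, b, hM⟩ | ⟨m, hm, ⟨a, b, hM⟩, hmax⟩
    · exact toSubgraph A _ a b hM
    · exact (small m (by omega) ⟨a, b, hM⟩ hmax).elim
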